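/- arXiv:1409.6229 — 2 statements merged into one kernel-verified Lean document; each statement's English description precedes it below -/
import Mathlib

section
/- For every λ ∈ ℝ \ {0} there exists a constant C > 0 such that for all μ ∈ ℂ with Re(μ) ≥ 0 and μ ≠ 0 and every fixed t > 0, the function x ↦ G(x,t,μ) is differentiable on (0,∞) and its derivative ∂ₓG satisfies, for all real numbers 0 < t ≤ x, |∂ₓG(x,t,μ)| ≤ C · ((1+|μ|x)/x)^{1/2} · (t/(1+|μ|t))^{1/2} · e^{Re(μ)(x−t)}. -/
open Filter

/-- Modified Bessel function of the first kind, via its series, with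
principal-branch complex powers. -/
noncomputable def besselI (ν z : ℂ) : ℂ :=
  ∑' k : ℕ, (z / 2) ^ (ν + 2 * (k : ℂ)) /
    (Complex.Gamma ((k : ℂ) + ν + 1) * (Nat.factorial k : ℂ))

/-- Modified Bessel function of the second kind (for `ν ∉ ℤ`). -/
noncomputable def besselK (ν z : ℂ) : ℂ :=
  (Real.pi / 2 : ℂ) * (besselI (-ν) z - besselI ν z) / Complex.sin (ν * Real.pi)

/-- The Green kernel `G(x,t,μ) = √(xt)·(I_{iλ}(μx)K_{iλ}(μt) − I_{iλ}(μt)K_{iλ}(μx))`. -/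
noncomputable def greenKernel (lam : ℝ) (x t : ℝ) (μ : ℂ) : ℂ :=
  (Real.sqrt (x * t) : ℂ) *
    (besselI (Complex.I * lam) (μ * x) * besselK (Complex.I * lam) (μ * t)
      - besselI (Complex.I * lam) (μ * t) * besselK (Complex.I * lam) (μ * x))

/-- The coefficient of `exp ((ν + 2k) s)` in the expansion of `besselI ν (μ * exp s)`. -/
noncomputable def besselCoeff (ν μ : ℂ) (k : ℕ) : ℂ :=
  (μ / 2) ^ (ν + 2 * (k : ℂ)) / (Complex.Gamma ((k : ℂ) + ν + 1) * (Nat.factorial k : ℂ))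

/-- The `j`-th derivative in `s` of `besselI ν (μ * exp s)`, as a series. -/
noncomputable def besselLogSeries (ν μ : ℂ) (j : ℕ) (s : ℝ) : ℂ :=
  ∑' k : ℕ, (ν + 2 * (k : ℂ)) ^ j * besselCoeff ν μ k * Complex.exp ((ν + 2 * (k : ℂ)) * s)

lemma besselI_mul_exp (ν : ℂ) {μ : ℂ} (hμ : μ ≠ 0) (s : ℝ) :
    besselI ν (μ * (Real.exp s : ℝ)) = besselLogSeries ν μ 0 s := by
  unfold besselI besselLogSeries besselCoeff
  refine tsum_congr fun k => ?_
  have h2 : μ / 2 ≠ 0 := div_ne_zero hμ two_ne_zero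
  have he : ((Real.exp s : ℝ) : ℂ) ≠ 0 := by exact_mod_cast (Real.exp_pos s).ne'
  have h1 : μ * (Real.exp s : ℝ) / 2 = (Real.exp s : ℝ) * (μ / 2) := by ring
  have h3 : (μ * (Real.exp s : ℝ) / 2) ^ (ν + 2 * (k : ℂ))
      = (μ / 2) ^ (ν + 2 * (k : ℂ)) * Complex.exp ((ν + 2 * (k : ℂ)) * s) := by
    rw [h1, Complex.cpow_def_of_ne_zero (mul_ne_zero he h2), Complex.cpow_def_of_ne_zero h2,
      Complex.log_ofReal_mul (Real.exp_pos s) h2, Real.log_exp, ← Complex.exp_add]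
    congr 1
    ring
  rw [h3]
  ring

lemma norm_Gamma_nat_add_ge {ν : ℂ} (hν : ν.re = 0) (k : ℕ) :
    ‖Complex.Gamma (ν + 1)‖ * (k.factorial : ℝ) ≤ ‖Complex.Gamma ((k : ℂ) + ν + 1)‖ := by
  induction k with
  | zero => simp
  | succ k ih =>
    have hne : (k : ℂ) + ν + 1 ≠ 0 := by
      intro h
      have := congrArg Complex.re h
      simp [hν] at this
      linarith [k.cast_nonneg (α := ℝ)]
    have hre : ((k : ℝ) + 1) ≤ ‖(k : ℂ) + ν + 1‖ := by
      have := Complex.re_le_norm ((k : ℂ) + ν + 1)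
      simpa [hν] using this
    have : ((k + 1 : ℕ) : ℂ) + ν + 1 = ((k : ℂ) + ν + 1) + 1 := by push_cast; ring
    rw [this, Complex.Gamma_add_one _ hne, norm_mul, Nat.factorial_succ]
    push_cast
    calc ‖Complex.Gamma (ν + 1)‖ * (((k : ℝ) + 1) * k.factorial)
        = ((k : ℝ) + 1) * (‖Complex.Gamma (ν + 1)‖ * k.factorial) := by ring
      _ ≤ _ := by gcongr

lemma Gamma_nat_add_ne_zero {ν : ℂ} (hν : ν.re = 0) (k : ℕ) :
    Complex.Gamma ((k : ℂ) + ν + 1) ≠ 0 := by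
  apply Complex.Gamma_ne_zero_of_re_pos
  simp [hν]
  positivity

lemma summable_besselLogSeries_bound {ν μ : ℂ} (hν : ν.re = 0) (hμ : μ ≠ 0) (j : ℕ) (S : ℝ) :
    Summable fun k : ℕ => ‖(ν + 2 * (k : ℂ)) ^ j * besselCoeff ν μ k‖ * Real.exp (2 * k * S) := by
  have hG : 0 < ‖Complex.Gamma (ν + 1)‖ := by
    simpa using Gamma_nat_add_ne_zero hν 0
  have h2 : μ / 2 ≠ 0 := div_ne_zero hμ two_ne_zero
  set r : ℝ := 2 ^ j * ‖μ / 2‖ ^ 2 * Real.exp (2 * S) with hr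
  refine Summable.of_nonneg_of_le (fun k => by positivity) (fun k => ?_)
    ((Real.summable_pow_div_factorial r).mul_left
      ((‖ν‖ + 2) ^ j * ‖(μ / 2) ^ ν‖ / ‖Complex.Gamma (ν + 1)‖))
  have hpow : ‖(ν + 2 * (k : ℂ)) ^ j‖ ≤ (‖ν‖ + 2) ^ j * (2 ^ j) ^ k := by
    rw [norm_pow, ← pow_mul, mul_comm j k, pow_mul, ← mul_pow]
    gcongr
    have h1 : ‖ν + 2 * (k : ℂ)‖ ≤ ‖ν‖ + 2 * k := by
      refine (norm_add_le _ _).trans ?_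
      simp
    have h3 : (k : ℝ) ≤ 2 ^ k := by exact_mod_cast (Nat.lt_two_pow_self (n := k)).le
    have h4 : (1 : ℝ) ≤ 2 ^ k := one_le_pow₀ (by norm_num)
    nlinarith [norm_nonneg ν]
  have hcoef : ‖besselCoeff ν μ k‖
      ≤ ‖(μ / 2) ^ ν‖ * (‖μ / 2‖ ^ 2) ^ k / (‖Complex.Gamma (ν + 1)‖ * k.factorial) := by
    have hc : (μ / 2) ^ (ν + 2 * (k : ℂ)) = (μ / 2) ^ ν * ((μ / 2) ^ 2) ^ k := by
      rw [Complex.cpow_add _ _ h2, ← pow_mul, ← Complex.cpow_natCast]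
      push_cast
      rfl
    unfold besselCoeff
    rw [hc, norm_div, norm_mul, norm_mul, norm_pow, norm_pow, Complex.norm_natCast]
    have h1 : (1 : ℝ) ≤ k.factorial := by exact_mod_cast Nat.one_le_iff_ne_zero.2 k.factorial_ne_zero
    have h3 := norm_Gamma_nat_add_ge hν k
    refine div_le_div_of_nonneg_left (by positivity) (by positivity) (h3.trans ?_)
    exact le_mul_of_one_le_right (norm_nonneg _) h1
  have hexp : Real.exp (2 * k * S) = Real.exp (2 * S) ^ k := by
    rw [← Real.exp_nat_mul]
    congr 1
    ring
  rw [norm_mul, hexp]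
  calc _ ≤ ((‖ν‖ + 2) ^ j * (2 ^ j) ^ k) * (‖(μ / 2) ^ ν‖ * (‖μ / 2‖ ^ 2) ^ k
            / (‖Complex.Gamma (ν + 1)‖ * k.factorial)) * Real.exp (2 * S) ^ k := by gcongr
    _ = _ := by
      rw [hr, mul_pow, mul_pow]
      field_simp

lemma norm_exp_besselLogSeries {ν : ℂ} (hν : ν.re = 0) (k : ℕ) (s : ℝ) :
    ‖Complex.exp ((ν + 2 * (k : ℂ)) * s)‖ = Real.exp (2 * k * s) := by
  rw [Complex.norm_exp]
  simp [hν]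

lemma summable_besselLogSeries {ν μ : ℂ} (hν : ν.re = 0) (hμ : μ ≠ 0) (j : ℕ) (s : ℝ) :
    Summable fun k : ℕ => (ν + 2 * (k : ℂ)) ^ j * besselCoeff ν μ k *
      Complex.exp ((ν + 2 * (k : ℂ)) * s) := by
  refine Summable.of_norm ?_
  simpa only [norm_mul, norm_exp_besselLogSeries hν] using
    summable_besselLogSeries_bound hν hμ j s

lemma hasDerivAt_besselLogSeries {ν μ : ℂ} (hν : ν.re = 0) (hμ : μ ≠ 0) (j : ℕ) (s : ℝ) :
    HasDerivAt (besselLogSeries ν μ j) (besselLogSeries ν μ (j + 1) s) s := by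
  refine hasDerivAt_tsum_of_isPreconnected (t := Set.Iio (s + 1)) (y₀ := s)
    (u := fun k : ℕ => ‖(ν + 2 * (k : ℂ)) ^ (j + 1) * besselCoeff ν μ k‖ *
      Real.exp (2 * k * (s + 1)))
    (summable_besselLogSeries_bound hν hμ (j + 1) (s + 1)) isOpen_Iio isPreconnected_Iio
    (g' := fun (k : ℕ) (s : ℝ) => (ν + 2 * (k : ℂ)) ^ (j + 1) * besselCoeff ν μ k *
      Complex.exp ((ν + 2 * (k : ℂ)) * s)) ?_ ?_ (by simp)
    (summable_besselLogSeries hν hμ j s) (by simp)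
  · intro k y _
    have h1 : HasDerivAt (fun z : ℂ => Complex.exp ((ν + 2 * (k : ℂ)) * z))
        (Complex.exp ((ν + 2 * (k : ℂ)) * (y : ℂ)) * (ν + 2 * (k : ℂ))) (y : ℂ) := by
      simpa using ((hasDerivAt_id (y : ℂ)).const_mul (ν + 2 * (k : ℂ))).cexp
    have h2 := h1.comp_ofReal.const_mul ((ν + 2 * (k : ℂ)) ^ j * besselCoeff ν μ k)
    exact h2.congr_deriv (by ring)
  · intro k y hy
    rw [norm_mul, norm_exp_besselLogSeries hν]
    have : y ≤ s + 1 := le_of_lt hy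
    gcongr

lemma besselCoeff_succ {ν μ : ℂ} (hν : ν.re = 0) (hμ : μ ≠ 0) (k : ℕ) :
    ((ν + 2 * ((k + 1 : ℕ) : ℂ)) ^ 2 - ν ^ 2) * besselCoeff ν μ (k + 1)
      = μ ^ 2 * besselCoeff ν μ k := by
  have h2 : μ / 2 ≠ 0 := div_ne_zero hμ two_ne_zero
  have hne : (k : ℂ) + ν + 1 ≠ 0 := by
    intro h
    have := congrArg Complex.re h
    simp [hν] at this
    linarith [k.cast_nonneg (α := ℝ)]
  have hc : (μ / 2) ^ (ν + 2 * ((k + 1 : ℕ) : ℂ)) = (μ / 2) ^ (ν + 2 * (k : ℂ)) * (μ / 2) ^ 2 := by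
    rw [← Complex.cpow_ofNat, ← Complex.cpow_add _ _ h2]
    congr 1
    push_cast
    ring
  have hg : ((k + 1 : ℕ) : ℂ) + ν + 1 = ((k : ℂ) + ν + 1) + 1 := by push_cast; ring
  have hk : (k : ℂ) + 1 ≠ 0 := by exact_mod_cast k.succ_ne_zero
  have hG := Gamma_nat_add_ne_zero hν k
  have hf : (k.factorial : ℂ) ≠ 0 := by exact_mod_cast k.factorial_ne_zero
  unfold besselCoeff
  rw [hc, hg, Complex.Gamma_add_one _ hne, Nat.factorial_succ]
  push_cast
  field_simp
  ring

lemma besselLogSeries_two {ν μ : ℂ} (hν : ν.re = 0) (hμ : μ ≠ 0) (s : ℝ) :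
    besselLogSeries ν μ 2 s =
      (μ ^ 2 * Complex.exp (2 * s) + ν ^ 2) * besselLogSeries ν μ 0 s := by
  have hS2 := summable_besselLogSeries hν hμ 2 s
  have hS0 := summable_besselLogSeries hν hμ 0 s
  have hS : besselLogSeries ν μ 2 s - ν ^ 2 * besselLogSeries ν μ 0 s =
      ∑' k : ℕ, ((ν + 2 * (k : ℂ)) ^ 2 - ν ^ 2) * besselCoeff ν μ k *
        Complex.exp ((ν + 2 * (k : ℂ)) * s) := by
    unfold besselLogSeries
    rw [← tsum_mul_left, ← hS2.tsum_sub (hS0.mul_left _)]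
    refine tsum_congr fun k => ?_
    ring
  have hsum : Summable fun k : ℕ => ((ν + 2 * (k : ℂ)) ^ 2 - ν ^ 2) * besselCoeff ν μ k *
        Complex.exp ((ν + 2 * (k : ℂ)) * s) := by
    refine (hS2.sub (hS0.mul_left (ν ^ 2))).congr fun k => ?_
    ring
  have hshift : ∑' k : ℕ, ((ν + 2 * (k : ℂ)) ^ 2 - ν ^ 2) * besselCoeff ν μ k *
        Complex.exp ((ν + 2 * (k : ℂ)) * s)
      = μ ^ 2 * Complex.exp (2 * s) * besselLogSeries ν μ 0 s := by
    rw [hsum.tsum_eq_zero_add]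
    unfold besselLogSeries
    rw [← tsum_mul_left]
    simp only [Nat.cast_zero, mul_zero, add_zero, sub_self, zero_mul, zero_add]
    refine tsum_congr fun k => ?_
    rw [besselCoeff_succ hν hμ]
    have : (ν + 2 * ((k + 1 : ℕ) : ℂ)) * s = 2 * s + (ν + 2 * (k : ℂ)) * s := by push_cast; ring
    rw [this, Complex.exp_add]
    ring
  rw [hshift] at hS
  linear_combination hS

lemma tendsto_exp_mul_besselLogSeries {ν μ : ℂ} (hν : ν.re = 0) (hμ : μ ≠ 0) (j : ℕ) :
    Tendsto (fun s : ℝ => Complex.exp (-ν * s) * besselLogSeries ν μ j s) atBot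
      (nhds (ν ^ j * besselCoeff ν μ 0)) := by
  have hsum : ∑' k : ℕ, (if k = 0 then ν ^ j * besselCoeff ν μ 0 else 0)
      = ν ^ j * besselCoeff ν μ 0 := by
    rw [tsum_eq_single 0 (fun k hk => by simp [hk])]
    simp
  rw [← hsum]
  have hfun : (fun s : ℝ => Complex.exp (-ν * s) * besselLogSeries ν μ j s) =
      fun s : ℝ => ∑' k : ℕ, (ν + 2 * (k : ℂ)) ^ j * besselCoeff ν μ k *
        ((Real.exp (2 * k * s) : ℝ) : ℂ) := by
    funext s
    unfold besselLogSeries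
    rw [← tsum_mul_left]
    refine tsum_congr fun k => ?_
    have : Complex.exp ((ν + 2 * (k : ℂ)) * s) =
        Complex.exp (ν * s) * ((Real.exp (2 * k * s) : ℝ) : ℂ) := by
      push_cast
      rw [← Complex.exp_add]
      congr 1
      ring
    rw [this, neg_mul, Complex.exp_neg]
    field_simp
  rw [hfun]
  refine tendsto_tsum_of_dominated_convergence (summable_besselLogSeries_bound hν hμ j 0) ?_ ?_
  · intro k
    rcases Nat.eq_zero_or_pos k with rfl | hk
    · simp
    · simp only [hk.ne', if_false]
      have h1 : Tendsto (fun s : ℝ => Real.exp (2 * k * s)) atBot (nhds 0) :=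
        Real.tendsto_exp_atBot.comp (tendsto_id.const_mul_atBot (by positivity))
      have h2 : Tendsto (fun s : ℝ => ((Real.exp (2 * k * s) : ℝ) : ℂ)) atBot (nhds 0) := by
        have := (Complex.continuous_ofReal.tendsto 0).comp h1
        simpa only [Complex.ofReal_zero, Function.comp_def] using this
      simpa using h2.const_mul ((ν + 2 * (k : ℂ)) ^ j * besselCoeff ν μ k)
  · filter_upwards [eventually_le_atBot (0 : ℝ)] with s hs k
    rw [norm_mul, Complex.norm_real, Real.norm_of_nonneg (Real.exp_pos _).le]
    have : 2 * (k : ℝ) * s ≤ 2 * k * 0 := by gcongr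
    gcongr

lemma besselLogSeries_wronskian {ν μ : ℂ} (hν : ν.re = 0) (hμ : μ ≠ 0) (s : ℝ) :
    besselLogSeries ν μ 1 s * besselLogSeries (-ν) μ 0 s
      - besselLogSeries ν μ 0 s * besselLogSeries (-ν) μ 1 s
      = 2 * ν / (Complex.Gamma (ν + 1) * Complex.Gamma (-ν + 1)) := by
  have hν' : (-ν).re = 0 := by simp [hν]
  set W : ℝ → ℂ := fun s => besselLogSeries ν μ 1 s * besselLogSeries (-ν) μ 0 s
      - besselLogSeries ν μ 0 s * besselLogSeries (-ν) μ 1 s with hW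
  have hd : ∀ s, HasDerivAt W 0 s := by
    intro s
    have h := ((hasDerivAt_besselLogSeries hν hμ 1 s).mul
      (hasDerivAt_besselLogSeries hν' hμ 0 s)).sub
      ((hasDerivAt_besselLogSeries hν hμ 0 s).mul (hasDerivAt_besselLogSeries hν' hμ 1 s))
    refine h.congr_deriv ?_
    simp only [Nat.reduceAdd, besselLogSeries_two hν hμ, besselLogSeries_two hν' hμ]
    ring
  have hconst : ∀ r, W r = W s := fun r =>
    is_const_of_deriv_eq_zero (fun x => (hd x).differentiableAt) (fun x => (hd x).deriv) r s
  have hlim : Tendsto W atBot (nhds (ν ^ 1 * besselCoeff ν μ 0 * ((-ν) ^ 0 * besselCoeff (-ν) μ 0)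
      - ν ^ 0 * besselCoeff ν μ 0 * ((-ν) ^ 1 * besselCoeff (-ν) μ 0))) := by
    refine (((tendsto_exp_mul_besselLogSeries hν hμ 1).mul
      (tendsto_exp_mul_besselLogSeries hν' hμ 0)).sub
      ((tendsto_exp_mul_besselLogSeries hν hμ 0).mul
      (tendsto_exp_mul_besselLogSeries hν' hμ 1))).congr fun r => ?_
    have : Complex.exp (-ν * r) * Complex.exp (- -ν * r) = 1 := by
      rw [← Complex.exp_add]
      simp
    simp only [hW]
    linear_combination (besselLogSeries ν μ 1 r * besselLogSeries (-ν) μ 0 r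
      - besselLogSeries ν μ 0 r * besselLogSeries (-ν) μ 1 r) * this
  have hWs : Tendsto W atBot (nhds (W s)) :=
    tendsto_const_nhds.congr fun r => (hconst r).symm
  have heq := tendsto_nhds_unique hWs hlim
  change W s = _
  rw [heq]
  have h2 : μ / 2 ≠ 0 := div_ne_zero hμ two_ne_zero
  have hp : (μ / 2) ^ ν ≠ 0 := by simp [Complex.cpow_eq_zero_iff, h2]
  have hG : Complex.Gamma (ν + 1) ≠ 0 := by simpa using Gamma_nat_add_ne_zero hν 0
  have hG' : Complex.Gamma (-ν + 1) ≠ 0 := by simpa using Gamma_nat_add_ne_zero hν' 0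
  have hc : besselCoeff ν μ 0 = (μ / 2) ^ ν / Complex.Gamma (ν + 1) := by simp [besselCoeff]
  have hc' : besselCoeff (-ν) μ 0 = ((μ / 2) ^ ν)⁻¹ / Complex.Gamma (-ν + 1) := by
    simp only [besselCoeff, Nat.cast_zero, mul_zero, add_zero, zero_add, Nat.factorial_zero,
      Nat.cast_one, mul_one]
    rw [Complex.cpow_neg]
  rw [hc, hc']
  field_simp
  ring

lemma le_mul_exp_of_deriv_le_mul {E E' φ φ' : ℝ → ℝ} (hE : ∀ s, HasDerivAt E (E' s) s)
    (hφ : ∀ s, HasDerivAt φ (φ' s) s) (h : ∀ s, E' s ≤ φ' s * E s) {s₀ s : ℝ} (hs : s₀ ≤ s) :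
    E s ≤ E s₀ * Real.exp (φ s - φ s₀) := by
  have hanti : Antitone fun s => E s * Real.exp (-φ s) := by
    refine antitone_of_hasDerivAt_nonpos (fun s => (hE s).mul (hφ s).neg.exp) fun s => ?_
    have := mul_le_mul_of_nonneg_right (h s) (Real.exp_pos (-φ s)).le
    simp only [Pi.zero_apply, Pi.neg_apply]
    linarith
  have h1 := mul_le_mul_of_nonneg_right (hanti hs) (Real.exp_pos (φ s)).le
  simp only [mul_assoc, ← Real.exp_add] at h1
  simpa [sub_eq_add_neg, add_comm] using h1

lemma inner_self_mul_left (a p : ℂ) : inner ℝ p (a * p) = a.re * ‖p‖ ^ 2 := by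
  rw [Complex.inner, mul_assoc, Complex.mul_conj, Complex.normSq_eq_norm_sq, Complex.re_mul_ofReal]

section LogarithmicEnergy

variable {lam : ℝ} {μ : ℂ} {h h₁ : ℝ → ℂ}

lemma log_energy_small (hlam : lam ≠ 0) (hd : ∀ s, HasDerivAt h (h₁ s) s)
    (hd₁ : ∀ s : ℝ, HasDerivAt h₁ ((μ ^ 2 * Complex.exp (2 * s) - lam ^ 2) * h s) s)
    {s₀ s : ℝ} (hs : s₀ ≤ s) (hμs : ‖μ‖ * Real.exp s ≤ 1) :
    ‖h₁ s‖ ^ 2 + lam ^ 2 * ‖h s‖ ^ 2 ≤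
      (‖h₁ s₀‖ ^ 2 + lam ^ 2 * ‖h s₀‖ ^ 2) * Real.exp (1 / (2 * |lam|)) := by
  have hl : 0 < |lam| := abs_pos.2 hlam
  have hE : ∀ s, HasDerivAt (fun s => ‖h₁ s‖ ^ 2 + lam ^ 2 * ‖h s‖ ^ 2)
      (2 * inner ℝ (h₁ s) ((μ ^ 2 * Complex.exp (2 * s) - lam ^ 2) * h s)
        + lam ^ 2 * (2 * inner ℝ (h s) (h₁ s))) s :=
    fun s => (hd₁ s).norm_sq.add ((hd s).norm_sq.const_mul _)
  have hφ : ∀ s, HasDerivAt (fun s => ‖μ‖ ^ 2 * Real.exp (2 * s) / (2 * |lam|))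
      (‖μ‖ ^ 2 * Real.exp (2 * s) / |lam|) s := by
    intro s
    have := (((hasDerivAt_id s).const_mul 2).exp.const_mul (‖μ‖ ^ 2)).div_const (2 * |lam|)
    refine this.congr_deriv ?_
    simp only [id, mul_one]
    field_simp
  refine (le_mul_exp_of_deriv_le_mul hE hφ (fun s => ?_) hs).trans ?_
  · have hi : inner ℝ (h₁ s) ((μ ^ 2 * Complex.exp (2 * s) - lam ^ 2) * h s)
        = inner ℝ (h₁ s) (μ ^ 2 * Complex.exp (2 * s) * h s)
          - lam ^ 2 * inner ℝ (h s) (h₁ s) := by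
      have : (μ ^ 2 * Complex.exp (2 * s) - lam ^ 2) * h s
          = μ ^ 2 * Complex.exp (2 * s) * h s - (lam ^ 2 : ℝ) • h s := by
        rw [Complex.real_smul]; push_cast; ring
      rw [this, inner_sub_right, real_inner_smul_right, real_inner_comm (h s)]
    have hn : ‖μ ^ 2 * Complex.exp (2 * s) * h s‖ = ‖μ‖ ^ 2 * Real.exp (2 * s) * ‖h s‖ := by
      rw [norm_mul, norm_mul, norm_pow, Complex.norm_exp]
      simp
    have hb := real_inner_le_norm (h₁ s) (μ ^ 2 * Complex.exp (2 * s) * h s)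
    rw [hn] at hb
    have hq : 2 * (‖h₁ s‖ * ‖h s‖) ≤ (‖h₁ s‖ ^ 2 + lam ^ 2 * ‖h s‖ ^ 2) / |lam| := by
      rw [le_div_iff₀ hl, ← sq_abs lam]
      nlinarith [sq_nonneg (‖h₁ s‖ - |lam| * ‖h s‖)]
    have hA : 0 ≤ ‖μ‖ ^ 2 * Real.exp (2 * s) := by positivity
    have := mul_le_mul_of_nonneg_left hq hA
    rw [hi]
    calc _ = 2 * inner ℝ (h₁ s) (μ ^ 2 * Complex.exp (2 * s) * h s) := by ring
      _ ≤ ‖μ‖ ^ 2 * Real.exp (2 * s) * (2 * (‖h₁ s‖ * ‖h s‖)) := by linarith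
      _ ≤ _ := this
      _ = _ := by ring
  · gcongr
    have h1 : ‖μ‖ ^ 2 * Real.exp (2 * s) ≤ 1 := by
      have : Real.exp (2 * s) = Real.exp s ^ 2 := by rw [← Real.exp_nat_mul]; norm_num
      rw [this, ← mul_pow]
      exact pow_le_one₀ (by positivity) hμs
    have h2 : 0 ≤ ‖μ‖ ^ 2 * Real.exp (2 * s₀) / (2 * |lam|) := by positivity
    have h3 : ‖μ‖ ^ 2 * Real.exp (2 * s) / (2 * |lam|) ≤ 1 / (2 * |lam|) := by gcongr
    linarith

/-- The sum of the squared norms of `√x (G' ± μ G)` at `x = exp s`, for `G x = √x * h (log x)`. -/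
noncomputable def logEnergy (μ : ℂ) (h h₁ : ℝ → ℂ) (s : ℝ) : ℝ :=
  ‖h₁ s + h s / 2 + μ * Real.exp s * h s‖ ^ 2 + ‖h₁ s + h s / 2 - μ * Real.exp s * h s‖ ^ 2

lemma logEnergy_eq (s : ℝ) :
    logEnergy μ h h₁ s = 2 * ‖h₁ s + h s / 2‖ ^ 2 + 2 * (‖μ‖ * Real.exp s) ^ 2 * ‖h s‖ ^ 2 := by
  have := parallelogram_law_with_norm ℝ (h₁ s + h s / 2) (μ * Real.exp s * h s)
  have hn : ‖μ * Real.exp s * h s‖ = ‖μ‖ * Real.exp s * ‖h s‖ := by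
    rw [norm_mul, norm_mul, Complex.norm_real, Real.norm_of_nonneg (Real.exp_pos s).le]
  rw [hn] at this
  unfold logEnergy
  linarith

lemma log_energy_large (hμ : μ ≠ 0) (hre : 0 ≤ μ.re) (hd : ∀ s, HasDerivAt h (h₁ s) s)
    (hd₁ : ∀ s : ℝ, HasDerivAt h₁ ((μ ^ 2 * Complex.exp (2 * s) - lam ^ 2) * h s) s)
    {s₀ s : ℝ} (hs : s₀ ≤ s) (hμs : 1 ≤ ‖μ‖ * Real.exp s₀) :
    logEnergy μ h h₁ s ≤ logEnergy μ h h₁ s₀ * (Real.exp (2 * (lam ^ 2 + 1 / 4)) *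
      Real.exp (s - s₀) * Real.exp (2 * (μ.re * (Real.exp s - Real.exp s₀)))) := by
  have hm : 0 < ‖μ‖ := norm_pos_iff.2 hμ
  set c : ℝ := lam ^ 2 + 1 / 4 with hc
  have hc0 : 0 < c := by positivity
  have hexpd : ∀ s : ℝ, HasDerivAt (fun s : ℝ => μ * (Real.exp s : ℂ) * h s)
      (μ * Real.exp s * h s + μ * Real.exp s * h₁ s) s := fun s =>
    (((Real.hasDerivAt_exp s).ofReal_comp).const_mul μ).mul (hd s)
  have hsq : ∀ s : ℝ, Complex.exp (2 * s) = (Real.exp s : ℂ) ^ 2 := fun s => by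
    push_cast; rw [← Complex.exp_nat_mul]; norm_num
  have hp : ∀ s, HasDerivAt (fun s => h₁ s + h s / 2 + μ * Real.exp s * h s)
      ((μ * Real.exp s + 1 / 2) * (h₁ s + h s / 2 + μ * Real.exp s * h s) - c • h s) s := by
    intro s
    refine (((hd₁ s).add ((hd s).div_const 2)).add (hexpd s)).congr_deriv ?_
    rw [hsq, Complex.real_smul, hc]
    push_cast
    ring
  have hq : ∀ s, HasDerivAt (fun s => h₁ s + h s / 2 - μ * Real.exp s * h s)
      ((-(μ * Real.exp s) + 1 / 2) * (h₁ s + h s / 2 - μ * Real.exp s * h s) - c • h s) s := by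
    intro s
    refine (((hd₁ s).add ((hd s).div_const 2)).sub (hexpd s)).congr_deriv ?_
    rw [hsq, Complex.real_smul, hc]
    push_cast
    ring
  have hE : ∀ s, HasDerivAt (logEnergy μ h h₁) _ s := fun s => (hp s).norm_sq.add (hq s).norm_sq
  have hφ : ∀ s, HasDerivAt (fun s => 2 * (μ.re * Real.exp s) + s - 2 * c / ‖μ‖ * Real.exp (-s))
      (2 * (μ.re * Real.exp s) + 1 + 2 * c / ‖μ‖ * Real.exp (-s)) s := by
    intro s
    refine (((((Real.hasDerivAt_exp s).const_mul μ.re).const_mul 2).add (hasDerivAt_id s)).sub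
      ((hasDerivAt_neg s).exp.const_mul (2 * c / ‖μ‖))).congr_deriv ?_
    ring
  have hmul : Real.exp (2 * c) * Real.exp (s - s₀) *
      Real.exp (2 * (μ.re * (Real.exp s - Real.exp s₀)))
      = Real.exp (2 * c + (s - s₀) + 2 * (μ.re * (Real.exp s - Real.exp s₀))) := by
    rw [Real.exp_add, Real.exp_add]
  rw [hmul]
  refine (le_mul_exp_of_deriv_le_mul hE hφ (fun s => ?_) hs).trans ?_
  · rw [inner_sub_right, inner_sub_right, inner_self_mul_left, inner_self_mul_left,
      real_inner_smul_right, real_inner_smul_right]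
    unfold logEnergy
    set p := h₁ s + h s / 2 + μ * Real.exp s * h s with hpdef
    set q := h₁ s + h s / 2 - μ * Real.exp s * h s with hqdef
    have hr1 : (μ * (Real.exp s : ℝ) + 1 / 2).re = μ.re * Real.exp s + 1 / 2 := by
      rw [Complex.add_re, Complex.re_mul_ofReal]; norm_num
    have hr2 : (-(μ * (Real.exp s : ℝ)) + 1 / 2).re = -(μ.re * Real.exp s) + 1 / 2 := by
      rw [Complex.add_re, Complex.neg_re, Complex.re_mul_ofReal]; norm_num
    rw [hr1, hr2]
    have hh : 2 * (‖μ‖ * Real.exp s) * ‖h s‖ ≤ ‖p‖ + ‖q‖ := by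
      have h1 : ‖p - q‖ = 2 * (‖μ‖ * Real.exp s) * ‖h s‖ := by
        have : p - q = 2 * (μ * Real.exp s) * h s := by rw [hpdef, hqdef]; ring
        rw [this, norm_mul, norm_mul, norm_mul, Complex.norm_real,
          Real.norm_of_nonneg (Real.exp_pos s).le]
        norm_num
      rw [← h1]
      exact norm_sub_le p q
    have hip : -(‖p‖ * ‖h s‖) ≤ inner ℝ p (h s) := (abs_le.1 (abs_real_inner_le_norm p (h s))).1
    have hiq : -(‖q‖ * ‖h s‖) ≤ inner ℝ q (h s) := (abs_le.1 (abs_real_inner_le_norm q (h s))).1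
    have hk : (‖p‖ + ‖q‖) * ‖h s‖ ≤ (‖p‖ ^ 2 + ‖q‖ ^ 2) / ‖μ‖ * Real.exp (-s) := by
      have h2 : ‖h s‖ ≤ (‖p‖ + ‖q‖) / (2 * (‖μ‖ * Real.exp s)) := by
        rw [le_div_iff₀ (by positivity)]; linarith
      calc (‖p‖ + ‖q‖) * ‖h s‖ ≤ (‖p‖ + ‖q‖) * ((‖p‖ + ‖q‖) / (2 * (‖μ‖ * Real.exp s))) := by gcongr
        _ = (‖p‖ + ‖q‖) ^ 2 / (2 * (‖μ‖ * Real.exp s)) := by ring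
        _ ≤ (2 * (‖p‖ ^ 2 + ‖q‖ ^ 2)) / (2 * (‖μ‖ * Real.exp s)) := by
          gcongr
          nlinarith [sq_nonneg (‖p‖ - ‖q‖)]
        _ = _ := by
          rw [Real.exp_neg]
          field_simp
    have hk' := mul_le_mul_of_nonneg_left hk (by positivity : 0 ≤ 2 * c)
    have hip' := mul_le_mul_of_nonneg_left hip hc0.le
    have hiq' := mul_le_mul_of_nonneg_left hiq hc0.le
    have hq0 : 0 ≤ μ.re * Real.exp s * ‖q‖ ^ 2 := by positivity
    have e1 : 2 * c / ‖μ‖ * Real.exp (-s) * (‖p‖ ^ 2 + ‖q‖ ^ 2)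
        = 2 * c * ((‖p‖ ^ 2 + ‖q‖ ^ 2) / ‖μ‖ * Real.exp (-s)) := by ring
    rw [add_mul _ (2 * c / ‖μ‖ * Real.exp (-s)), e1]
    nlinarith
  · have hE0 : 0 ≤ logEnergy μ h h₁ s₀ := by unfold logEnergy; positivity
    gcongr
    have h1 : 2 * c / ‖μ‖ * Real.exp (-s₀) ≤ 2 * c := by
      rw [Real.exp_neg, ← div_eq_mul_inv, div_div, div_le_iff₀ (by positivity)]
      nlinarith
    have h2 : 0 ≤ 2 * c / ‖μ‖ * Real.exp (-s) := by positivity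
    linarith

lemma norm_add_half_sq_le (hlam : lam ≠ 0) (hμ : μ ≠ 0) (hre : 0 ≤ μ.re)
    (hd : ∀ s, HasDerivAt h (h₁ s) s)
    (hd₁ : ∀ s : ℝ, HasDerivAt h₁ ((μ ^ 2 * Complex.exp (2 * s) - lam ^ 2) * h s) s)
    {s₀ s : ℝ} (h0 : h s₀ = 0) (hs : s₀ ≤ s) :
    ‖h₁ s + h s / 2‖ ^ 2 ≤
      4 * (1 + 1 / lam ^ 2) * Real.exp (1 / (2 * |lam|)) * Real.exp (2 * (lam ^ 2 + 1 / 4)) *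
        (‖h₁ s₀‖ ^ 2 * ((1 + ‖μ‖ * Real.exp s) / (1 + ‖μ‖ * Real.exp s₀)) *
          Real.exp (2 * (μ.re * (Real.exp s - Real.exp s₀)))) := by
  have hm : 0 < ‖μ‖ := norm_pos_iff.2 hμ
  have hL : 0 < lam ^ 2 := by positivity
  set A := ‖h₁ s₀‖ ^ 2 with hA
  have hA0 : 0 ≤ A := by positivity
  set K₁ := Real.exp (1 / (2 * |lam|))
  set K₂ := Real.exp (2 * (lam ^ 2 + 1 / 4))
  have hK₁ : 1 ≤ K₁ := Real.one_le_exp (by positivity)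
  have hK₂ : 1 ≤ K₂ := Real.one_le_exp (by positivity)
  have hxt : Real.exp s₀ ≤ Real.exp s := Real.exp_le_exp.2 hs
  set e := Real.exp (2 * (μ.re * (Real.exp s - Real.exp s₀))) with he
  have he1 : 1 ≤ e := Real.one_le_exp (by
    have := sub_nonneg.2 hxt
    positivity)
  set ρ := (1 + ‖μ‖ * Real.exp s) / (1 + ‖μ‖ * Real.exp s₀) with hρ
  have hρ1 : 1 ≤ ρ := by
    rw [hρ, one_le_div (by positivity)]
    gcongr
  have hL1 : 0 ≤ 1 / lam ^ 2 := by positivity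
  have hsmall : ∀ r, s₀ ≤ r → ‖μ‖ * Real.exp r ≤ 1 →
      ‖h₁ r + h r / 2‖ ^ 2 ≤ (2 + 1 / lam ^ 2) * K₁ * A ∧ ‖h r‖ ^ 2 ≤ 1 / lam ^ 2 * K₁ * A := by
    intro r hr hr1
    have hE := log_energy_small hlam hd hd₁ hr hr1
    rw [h0, norm_zero, ← hA] at hE
    have hh : ‖h r‖ ^ 2 ≤ 1 / lam ^ 2 * K₁ * A := by
      rw [one_div, mul_assoc, inv_mul_eq_div, le_div_iff₀ hL]
      nlinarith [sq_nonneg ‖h₁ r‖]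
    refine ⟨?_, hh⟩
    have htri : ‖h₁ r + h r / 2‖ ≤ ‖h₁ r‖ + ‖h r‖ / 2 := by
      refine (norm_add_le _ _).trans ?_
      simp
    have hsq : ‖h₁ r + h r / 2‖ ^ 2 ≤ (‖h₁ r‖ + ‖h r‖ / 2) ^ 2 := by gcongr
    nlinarith [sq_nonneg (‖h₁ r‖ - ‖h r‖ / 2), sq_nonneg ‖h r‖, sq_nonneg (lam * ‖h r‖)]
  have hhalf : ∀ r, ‖h₁ r + h r / 2‖ ^ 2 ≤ logEnergy μ h h₁ r / 2 := by
    intro r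
    rw [logEnergy_eq]
    have : 0 ≤ (‖μ‖ * Real.exp r) ^ 2 * ‖h r‖ ^ 2 := by positivity
    linarith
  rcases le_total (‖μ‖ * Real.exp s) 1 with hx | hx
  · calc _ ≤ (2 + 1 / lam ^ 2) * K₁ * A := (hsmall s hs hx).1
      _ ≤ (4 * (1 + 1 / lam ^ 2)) * K₁ * 1 * (A * 1 * 1) := by
        have : 0 ≤ K₁ * A := by positivity
        nlinarith
      _ ≤ _ := by gcongr
  rcases le_total 1 (‖μ‖ * Real.exp s₀) with ht | ht
  · have hE := log_energy_large hμ hre hd hd₁ hs ht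
    rw [logEnergy_eq (s := s₀), h0] at hE
    simp only [zero_div, add_zero, norm_zero, ← hA, ← he] at hE
    have hr : Real.exp (s - s₀) ≤ 2 * ρ := by
      rw [Real.exp_sub, hρ, ← mul_div_assoc, div_le_div_iff₀ (by positivity) (by positivity)]
      have := Real.exp_pos s₀
      nlinarith [mul_le_mul_of_nonneg_right ht (Real.exp_pos s).le]
    calc _ ≤ A * (K₂ * Real.exp (s - s₀) * e) := by
          refine (hhalf s).trans ?_
          have : (0 : ℝ) ^ 2 = 0 := by norm_num
          rw [this] at hE
          linarith
      _ ≤ A * (K₂ * (2 * ρ) * e) := by gcongr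
      _ = 2 * 1 * K₂ * (A * ρ * e) := by ring
      _ ≤ _ := by
        gcongr
        linarith
  · set a := -Real.log ‖μ‖ with ha
    have hea : Real.exp a = ‖μ‖⁻¹ := by rw [ha, Real.exp_neg, Real.exp_log hm]
    have hma : ‖μ‖ * Real.exp a = 1 := by rw [hea, mul_inv_cancel₀ hm.ne']
    have hsa : s₀ ≤ a := by
      rw [← Real.exp_le_exp, ← mul_le_mul_iff_right₀ hm, hma]
      exact ht
    have has : a ≤ s := by
      rw [← Real.exp_le_exp, ← mul_le_mul_iff_right₀ hm, hma]
      exact hx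
    obtain ⟨hz, hh⟩ := hsmall a hsa hma.le
    have hEa : logEnergy μ h h₁ a ≤ 4 * (1 + 1 / lam ^ 2) * K₁ * A := by
      rw [logEnergy_eq, hma]
      linarith
    have hE := log_energy_large hμ hre hd hd₁ has hma.ge
    have hr : Real.exp (s - a) ≤ 2 * ρ := by
      rw [Real.exp_sub, hea, div_inv_eq_mul, hρ, ← mul_div_assoc, le_div_iff₀ (by positivity)]
      nlinarith [mul_le_mul_of_nonneg_left ht (by positivity : 0 ≤ ‖μ‖ * Real.exp s)]
    have hexp : Real.exp (2 * (μ.re * (Real.exp s - Real.exp a))) ≤ e := by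
      rw [he]
      have := Real.exp_le_exp.2 hsa
      gcongr
    calc _ ≤ logEnergy μ h h₁ s / 2 := hhalf s
      _ ≤ (4 * (1 + 1 / lam ^ 2) * K₁ * A) * (K₂ * (2 * ρ) * e) / 2 := by
        refine div_le_div_of_nonneg_right (hE.trans ?_) two_pos.le
        gcongr
      _ = _ := by ring

end LogarithmicEnergy

/-- The function `h` such that `greenKernel lam x t μ = √x * h (log x)`, differentiated `j` times,
with `s₀ = log t`. -/
noncomputable def greenLog (lam : ℝ) (μ : ℂ) (s₀ : ℝ) (j : ℕ) (s : ℝ) : ℂ :=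
  Real.sqrt (Real.exp s₀) * ((Real.pi / 2 : ℂ) / Complex.sin (Complex.I * lam * Real.pi)) *
    (besselLogSeries (Complex.I * lam) μ j s * besselLogSeries (-(Complex.I * lam)) μ 0 s₀
      - besselLogSeries (Complex.I * lam) μ 0 s₀ * besselLogSeries (-(Complex.I * lam)) μ j s)

lemma greenKernel_exp (lam : ℝ) {μ : ℂ} (hμ : μ ≠ 0) (s s₀ : ℝ) :
    greenKernel lam (Real.exp s) (Real.exp s₀) μ =
      Real.sqrt (Real.exp s) * greenLog lam μ s₀ 0 s := by
  unfold greenKernel greenLog besselK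
  rw [Real.sqrt_mul (Real.exp_pos s).le]
  simp only [besselI_mul_exp _ hμ, Complex.ofReal_mul]
  ring

lemma hasDerivAt_greenLog (lam : ℝ) {μ : ℂ} (hμ : μ ≠ 0) (s₀ : ℝ) (j : ℕ) (s : ℝ) :
    HasDerivAt (greenLog lam μ s₀ j) (greenLog lam μ s₀ (j + 1) s) s :=
  (((hasDerivAt_besselLogSeries (by simp) hμ j s).mul_const _).sub
    ((hasDerivAt_besselLogSeries (by simp) hμ j s).const_mul _)).const_mul _

lemma greenLog_two (lam : ℝ) {μ : ℂ} (hμ : μ ≠ 0) (s₀ s : ℝ) :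
    greenLog lam μ s₀ 2 s =
      (μ ^ 2 * Complex.exp (2 * s) - lam ^ 2) * greenLog lam μ s₀ 0 s := by
  unfold greenLog
  rw [besselLogSeries_two (by simp) hμ, besselLogSeries_two (by simp) hμ, neg_sq, mul_pow,
    Complex.I_sq]
  ring

lemma greenLog_one_self (lam : ℝ) {μ : ℂ} (hμ : μ ≠ 0) (s₀ : ℝ) :
    greenLog lam μ s₀ 1 s₀ = Real.sqrt (Real.exp s₀) *
      ((Real.pi / 2 : ℂ) / Complex.sin (Complex.I * lam * Real.pi) * (2 * (Complex.I * lam) /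
        (Complex.Gamma (Complex.I * lam + 1) * Complex.Gamma (-(Complex.I * lam) + 1)))) := by
  unfold greenLog
  rw [besselLogSeries_wronskian (by simp) hμ, mul_assoc]

lemma hasDerivAt_greenKernel (lam : ℝ) {μ : ℂ} (hμ : μ ≠ 0) {t x : ℝ} (ht : 0 < t) (hx : 0 < x) :
    HasDerivAt (fun x' : ℝ => greenKernel lam x' t μ)
      ((greenLog lam μ (Real.log t) 1 (Real.log x) + greenLog lam μ (Real.log t) 0 (Real.log x) / 2)
        / Real.sqrt x) x := by
  have hg : HasDerivAt (fun x' : ℝ => (Real.sqrt x' : ℂ) * greenLog lam μ (Real.log t) 0 (Real.log x'))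
      ((greenLog lam μ (Real.log t) 1 (Real.log x) + greenLog lam μ (Real.log t) 0 (Real.log x) / 2)
        / Real.sqrt x) x := by
    have h1 := (Real.hasDerivAt_sqrt hx.ne').ofReal_comp
    have h2 := (hasDerivAt_greenLog lam hμ (Real.log t) 0 (Real.log x)).scomp x
      (Real.hasDerivAt_log hx.ne')
    refine (h1.mul h2).congr_deriv ?_
    have hs : (Real.sqrt x : ℂ) ≠ 0 := by exact_mod_cast (Real.sqrt_pos.2 hx).ne'
    have hxs : (x : ℂ) = (Real.sqrt x : ℂ) ^ 2 := by
      exact_mod_cast (Real.sq_sqrt hx.le).symm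
    simp only [Complex.real_smul, Function.comp_apply, zero_add]
    push_cast
    rw [hxs]
    field_simp
    ring
  refine hg.congr_of_eventuallyEq ?_
  filter_upwards [lt_mem_nhds hx] with y hy
  simpa only [Real.exp_log hy, Real.exp_log ht] using
    greenKernel_exp lam hμ (Real.log y) (Real.log t)

/-- Derivative estimate on the Green kernel: for every `λ ≠ 0` there is `C > 0` such
that for all `μ` with `Re μ ≥ 0`, `μ ≠ 0`, and every fixed `t > 0`, the function
`x ↦ G(x,t,μ)` is differentiable on `(0,∞)` and for all `0 < t ≤ x`,
`|∂ₓG(x,t,μ)| ≤ C ((1+|μ|x)/x)^{1/2} (t/(1+|μ|t))^{1/2} e^{Re(μ)(x−t)}`. -/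
theorem stmt2 (lam : ℝ) (hlam : lam ≠ 0) :
    ∃ C : ℝ, 0 < C ∧ ∀ μ : ℂ, 0 ≤ μ.re → μ ≠ 0 → ∀ t : ℝ, 0 < t →
      (∀ x : ℝ, 0 < x → DifferentiableAt ℝ (fun x' : ℝ => greenKernel lam x' t μ) x) ∧
      (∀ x : ℝ, t ≤ x →
        ‖deriv (fun x' : ℝ => greenKernel lam x' t μ) x‖ ≤
          C * Real.sqrt ((1 + ‖μ‖ * x) / x) * Real.sqrt (t / (1 + ‖μ‖ * t)) *
            Real.exp (μ.re * (x - t))) := by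
  set κ : ℂ := (Real.pi / 2 : ℂ) / Complex.sin (Complex.I * lam * Real.pi) *
    (2 * (Complex.I * lam) /
      (Complex.Gamma (Complex.I * lam + 1) * Complex.Gamma (-(Complex.I * lam) + 1))) with hκ
  set M : ℝ := 4 * (1 + 1 / lam ^ 2) * Real.exp (1 / (2 * |lam|)) *
    Real.exp (2 * (lam ^ 2 + 1 / 4)) with hM
  have hM0 : 0 ≤ M := by positivity
  refine ⟨Real.sqrt (M * ‖κ‖ ^ 2 + 1), by positivity, fun μ hre hμ t ht =>
    ⟨fun x hx => (hasDerivAt_greenKernel lam hμ ht hx).differentiableAt, fun x htx => ?_⟩⟩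
  have hx : 0 < x := ht.trans_le htx
  have hd₁ : ∀ s : ℝ, HasDerivAt (greenLog lam μ (Real.log t) 1)
      ((μ ^ 2 * Complex.exp (2 * s) - lam ^ 2) * greenLog lam μ (Real.log t) 0 s) s := by
    intro s
    rw [← greenLog_two lam hμ]
    exact hasDerivAt_greenLog lam hμ _ 1 s
  have hmain := norm_add_half_sq_le hlam hμ hre (hasDerivAt_greenLog lam hμ (Real.log t) 0) hd₁
    (s₀ := Real.log t) (by unfold greenLog; ring) (Real.log_le_log ht htx)
  simp only [zero_add] at hmain
  rw [greenLog_one_self lam hμ, ← hκ, norm_mul, Complex.norm_real, mul_pow, Real.exp_log ht,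
    Real.exp_log hx, Real.norm_of_nonneg (Real.sqrt_nonneg t), Real.sq_sqrt ht.le, ← hM] at hmain
  have hexp : Real.exp (μ.re * (x - t)) ^ 2 = Real.exp (2 * (μ.re * (x - t))) := by
    rw [← Real.exp_nat_mul]
    norm_num
  rw [(hasDerivAt_greenKernel lam hμ ht hx).deriv, norm_div, Complex.norm_real,
    Real.norm_of_nonneg (Real.sqrt_nonneg x),
    ← pow_le_pow_iff_left₀ (by positivity) (by positivity) two_ne_zero, div_pow,
    Real.sq_sqrt hx.le, mul_pow, mul_pow, mul_pow, Real.sq_sqrt (by positivity),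
    Real.sq_sqrt (by positivity), Real.sq_sqrt (by positivity), hexp, div_le_iff₀ hx]
  calc _ ≤ _ := hmain
    _ = M * ‖κ‖ ^ 2 * ((1 + ‖μ‖ * x) / x) * (t / (1 + ‖μ‖ * t)) *
        Real.exp (2 * (μ.re * (x - t))) * x := by
      field_simp
    _ ≤ _ := by
      gcongr
      linarith
end

section
/- Fix A > 0, R ≥ 0, r ∈ ℝ and C > 0. Let q₀ : (0,A) → ℂ be measurable with Q(x) := ∫₀^x t·|q₀(t)|/(1+R·t) dt < ∞ for every x ∈ (0,A). Let G : {(x,t) : 0 < t ≤ x < A} → ℂ satisfy |G(x,t)| ≤ C·(x/(1+R·x))^{1/2}·(t/(1+R·t))^{1/2}·e^{r(x−t)} for all 0 < t ≤ x < A. Let g₀ : (0,A) → ℂ be measurable with |g₀(x)| ≤ C·(x/(1+R·x))^{1/2}·e^{r·x}, and define recursively g_{k+1}(x) = −∫₀^x G(x,t)·q₀(t)·g_k(t) dt. Then for every x ∈ (0,A) the series ∑_{k≥0} g_k(x) converges absolutely, and its sum S(x) satisfies |S(x)| ≤ C·(x/(1+R·x))^{1/2}·e^{r·x}·exp(C·Q(x))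 and |S(x) − g₀(x)| ≤ C·(x/(1+R·x))^{1/2}·e^{r·x}·(exp(C·Q(x)) − 1). -/
open MeasureTheory

theorem absolutelyContinuousOnInterval_pow {f : ℝ → ℝ} {a b : ℝ}
    (hf : AbsolutelyContinuousOnInterval f a b) (n : ℕ) :
    AbsolutelyContinuousOnInterval (fun x => f x ^ n) a b := by
  induction n with
  | zero =>
    simpa using ((LipschitzWith.const (1 : ℝ)).lipschitzOnWith
      (s := Set.uIcc a b)).absolutelyContinuousOnInterval
  | succ n ih => simpa only [pow_succ] using ih.fun_mul hf

theorem intervalIntegrable_mul_primitive_pow {h : ℝ → ℝ} {a b : ℝ}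
    (hh : IntervalIntegrable h volume a b) (k : ℕ) :
    IntervalIntegrable (fun t => h t * (∫ s in a..t, h s) ^ k) volume a b :=
  hh.mul_continuousOn ((absolutelyContinuousOnInterval_pow
    (hh.absolutelyContinuousOnInterval_intervalIntegral (c := a) (by simp)) k).continuousOn)

/-- The chain rule for powers of the primitive of an integrable function, in integrated form. -/
theorem integral_mul_primitive_pow {h : ℝ → ℝ} {a b : ℝ}
    (hh : IntervalIntegrable h volume a b) (k : ℕ) :
    ∫ t in a..b, h t * (∫ s in a..t, h s) ^ k = (∫ t in a..b, h t) ^ (k + 1) / (k + 1) := by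
  have hF := absolutelyContinuousOnInterval_pow
    (hh.absolutelyContinuousOnInterval_intervalIntegral (c := a) (by simp)) (k + 1)
  have hderiv : ∫ t in a..b, deriv (fun x => (∫ s in a..x, h s) ^ (k + 1)) t =
      ∫ t in a..b, ((k : ℝ) + 1) * (h t * (∫ s in a..t, h s) ^ k) := by
    apply intervalIntegral.integral_congr_ae
    filter_upwards [hh.ae_hasDerivAt_integral] with t ht hmem
    have hd := (ht (Set.uIoc_subset_uIcc hmem) a (by simp)).pow (k + 1)
    refine Eq.trans (HasDerivAt.deriv hd) ?_
    push_cast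
    ring
  have hk : (k : ℝ) + 1 ≠ 0 := by positivity
  rw [hF.integral_deriv_eq_sub, intervalIntegral.integral_const_mul] at hderiv
  rw [eq_div_iff hk, mul_comm, ← hderiv]
  simp

/-- One step of the Picard iteration: the `k`-th Volterra bound is turned into the next one. -/
theorem norm_volterra_integral_le {w h : ℝ → ℝ} {x C r : ℝ} {K q f : ℝ → ℂ} (k : ℕ)
    (hC : 0 ≤ C) (hx : 0 ≤ x) (hw : ∀ t ∈ Set.Ioo 0 x, 0 ≤ w t) (hwx : 0 ≤ w x)
    (hh : IntervalIntegrable h volume 0 x)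
    (hwh : ∀ t ∈ Set.Ioo 0 x, w t * w t * ‖q t‖ = h t)
    (hK : ∀ t ∈ Set.Ioo 0 x, ‖K t‖ ≤ C * w x * w t * Real.exp (r * (x - t)))
    (hf : ∀ t ∈ Set.Ioo 0 x,
      ‖f t‖ ≤ C * w t * Real.exp (r * t) * ((C * ∫ s in 0..t, h s) ^ k / k.factorial)) :
    ‖∫ t in Set.Ioo 0 x, K t * q t * f t‖ ≤
      C * w x * Real.exp (r * x) * ((C * ∫ s in 0..x, h s) ^ (k + 1) / (k + 1).factorial) := by
  set D : ℝ := C * w x * Real.exp (r * x) * (C ^ (k + 1) / k.factorial) with hD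
  have hint : IntegrableOn (fun t => D * (h t * (∫ s in 0..t, h s) ^ k)) (Set.Ioo 0 x) :=
    (((intervalIntegrable_iff_integrableOn_Ioo_of_le hx).1
      (intervalIntegrable_mul_primitive_pow hh k))).const_mul D
  have hle : ‖∫ t in Set.Ioo 0 x, K t * q t * f t‖ ≤
      ∫ t in Set.Ioo 0 x, D * (h t * (∫ s in 0..t, h s) ^ k) := by
    refine norm_integral_le_of_norm_le hint ?_
    filter_upwards [ae_restrict_mem measurableSet_Ioo] with t ht
    have hwt := hw t ht
    have hexp : Real.exp (r * x) = Real.exp (r * (x - t)) * Real.exp (r * t) := by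
      rw [← Real.exp_add]; ring_nf
    rw [norm_mul, norm_mul]
    calc ‖K t‖ * ‖q t‖ * ‖f t‖
        ≤ (C * w x * w t * Real.exp (r * (x - t))) * ‖q t‖ *
          (C * w t * Real.exp (r * t) * ((C * ∫ s in 0..t, h s) ^ k / k.factorial)) := by
          gcongr
          · exact hK t ht
          · exact hf t ht
      _ = D * (h t * (∫ s in 0..t, h s) ^ k) := by
          rw [hD, hexp, ← hwh t ht, mul_pow]; ring
  refine hle.trans (le_of_eq ?_)
  rw [integral_const_mul, ← integral_Ioc_eq_integral_Ioo, ← intervalIntegral.integral_of_le hx,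
    integral_mul_primitive_pow hh, hD, Nat.factorial_succ, mul_pow]
  push_cast
  field_simp

/-- A series dominated termwise by `M * a ^ k / k!` converges absolutely, with exponential bounds
for its sum and for its first remainder. -/
theorem summable_and_norm_tsum_le_of_le_exp_series {E : Type*} [NormedAddCommGroup E]
    [CompleteSpace E] {u : ℕ → E} {M a : ℝ}
    (hu : ∀ k, ‖u k‖ ≤ M * (a ^ k / k.factorial)) :
    Summable (fun k => ‖u k‖) ∧ ‖∑' k, u k‖ ≤ M * Real.exp a ∧
      ‖(∑' k, u k) - u 0‖ ≤ M * (Real.exp a - 1) := by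
  have hexp : HasSum (fun k : ℕ => a ^ k / k.factorial) (Real.exp a) := by
    rw [Real.exp_eq_exp_ℝ]
    exact NormedSpace.expSeries_div_hasSum_exp a
  have hM := hexp.mul_left M
  have hs : Summable (fun k => ‖u k‖) := hM.summable.of_nonneg_of_le (fun _ => norm_nonneg _) hu
  refine ⟨hs, tsum_of_norm_bounded hM hu, ?_⟩
  have htail : HasSum (fun k : ℕ => M * (a ^ (k + 1) / (k + 1).factorial))
      (M * (Real.exp a - 1)) := by
    refine HasSum.mul_left M ?_
    simpa using (hasSum_nat_add_iff' 1).2 hexp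
  rw [hs.of_norm.tsum_eq_zero_add, add_sub_cancel_left]
  exact tsum_of_norm_bounded htail fun k => hu (k + 1)

/-- Convergence and remainder estimate for the iterated series solving the
Volterra-type integral equation: with `Q(x) = ∫₀^x t|q₀(t)|/(1+Rt) dt`, the series
`∑ g_k(x)` converges absolutely, with `|S(x)| ≤ C√(x/(1+Rx))e^{rx}e^{CQ(x)}` and
`|S(x) − g₀(x)| ≤ C√(x/(1+Rx))e^{rx}(e^{CQ(x)} − 1)`. -/
theorem stmt6 (A R r C : ℝ) (hA : 0 < A) (hR : 0 ≤ R) (hC : 0 < C)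
    (q₀ : ℝ → ℂ) (hq₀meas : Measurable q₀)
    (hQfin : ∀ x ∈ Set.Ioo (0 : ℝ) A,
      IntegrableOn (fun t : ℝ => t * ‖q₀ t‖ / (1 + R * t)) (Set.Ioo 0 x))
    (G : ℝ → ℝ → ℂ)
    (hG : ∀ x t : ℝ, 0 < t → t ≤ x → x < A →
      ‖G x t‖ ≤ C * Real.sqrt (x / (1 + R * x)) * Real.sqrt (t / (1 + R * t)) *
        Real.exp (r * (x - t)))
    (g : ℕ → ℝ → ℂ)
    (hg0meas : AEStronglyMeasurable (g 0) (volume.restrict (Set.Ioo 0 A)))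
    (hg0 : ∀ x ∈ Set.Ioo (0 : ℝ) A,
      ‖g 0 x‖ ≤ C * Real.sqrt (x / (1 + R * x)) * Real.exp (r * x))
    (hgrec : ∀ k : ℕ, ∀ x ∈ Set.Ioo (0 : ℝ) A,
      g (k + 1) x = -∫ t in Set.Ioo (0 : ℝ) x, G x t * q₀ t * g k t) :
    ∀ x ∈ Set.Ioo (0 : ℝ) A,
      Summable (fun k : ℕ => ‖g k x‖) ∧
      ‖∑' k : ℕ, g k x‖ ≤ C * Real.sqrt (x / (1 + R * x)) * Real.exp (r * x) *
        Real.exp (C * ∫ t in Set.Ioo (0 : ℝ) x, t * ‖q₀ t‖ / (1 + R * t)) ∧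
      ‖(∑' k : ℕ, g k x) - g 0 x‖ ≤
        C * Real.sqrt (x / (1 + R * x)) * Real.exp (r * x) *
          (Real.exp (C * ∫ t in Set.Ioo (0 : ℝ) x, t * ‖q₀ t‖ / (1 + R * t)) - 1) := by
  set w : ℝ → ℝ := fun x => Real.sqrt (x / (1 + R * x)) with hw
  set h : ℝ → ℝ := fun t => t * ‖q₀ t‖ / (1 + R * t) with hh
  have hInt : ∀ x ∈ Set.Ioo (0 : ℝ) A, IntervalIntegrable h volume 0 x := fun x hx =>
    (intervalIntegrable_iff_integrableOn_Ioo_of_le hx.1.le).2 (hQfin x hx)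
  have hwh : ∀ t : ℝ, 0 < t → w t * w t * ‖q₀ t‖ = h t := by
    intro t ht
    simp only [hw, hh]
    rw [Real.mul_self_sqrt (by positivity)]
    ring
  have hbound : ∀ k : ℕ, ∀ x ∈ Set.Ioo (0 : ℝ) A,
      ‖g k x‖ ≤ C * w x * Real.exp (r * x) * ((C * ∫ s in 0..x, h s) ^ k / k.factorial) := by
    intro k
    induction k with
    | zero => simpa using hg0
    | succ k ih =>
      intro x hx
      rw [hgrec k x hx, norm_neg]
      exact norm_volterra_integral_le k hC.le hx.1.le (fun t _ => Real.sqrt_nonneg _)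
        (Real.sqrt_nonneg _) (hInt x hx) (fun t ht => hwh t ht.1)
        (fun t ht => hG x t ht.1 ht.2.le hx.2) (fun t ht => ih t ⟨ht.1, ht.2.trans hx.2⟩)
  intro x hx
  rw [← integral_Ioc_eq_integral_Ioo, ← intervalIntegral.integral_of_le hx.1.le]
  exact summable_and_norm_tsum_le_of_le_exp_series fun k => hbound k x hx
end
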